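/- arXiv:2605.25551 — 5 statements merged into one kernel-verified Lean document; each statement's English description precedes it below -/
import Mathlib

section
/- Let n ≥ 2, δ > 0, and β > 0, and let C be the symmetric margin cost on n elements with margin δ. Set a = 1/(1 + (n−1)e^{−βδ}) and b = a·e^{−βδ}. Then the n×n matrix P* with P*_{ii} = a for all i and P*_{ij} = b for all i ≠ j is doubly stochastic, satisfies a + (n−1)b = 1 and a/b = e^{βδ}, and is the unique minimizer of the entropic assignment objective F_{C,1/β} over the Birkhoff polytope B_n. -/
open scoped BigOperators

/-- An `n × n` real matrix is doubly stochastic if all entries are nonnegative and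
every row and every column sums to `1`. -/
def IsDoublyStochastic {ι : Type*} [Fintype ι] (P : Matrix ι ι ℝ) : Prop :=
  (∀ i j, 0 ≤ P i j) ∧ (∀ i, ∑ j, P i j = 1) ∧ (∀ j, ∑ i, P i j = 1)

/-- The entropic assignment objective
`F_{C,ε}(P) = Σ_{i,j} C_{ij} P_{ij} + ε Σ_{i,j} P_{ij} log P_{ij}`. -/
noncomputable def entObj {ι : Type*} [Fintype ι] (C : Matrix ι ι ℝ) (ε : ℝ)
    (P : Matrix ι ι ℝ) : ℝ :=
  (∑ i, ∑ j, C i j * P i j) + ε * ∑ i, ∑ j, P i j * Real.log (P i j)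

/-- The symmetric margin cost with margin `m`: zero on the diagonal, `m` off the diagonal. -/
def marginCost (n : ℕ) (m : ℝ) : Matrix (Fin n) (Fin n) ℝ :=
  fun i j => if i = j then 0 else m

open InformationTheory in
theorem mul_klFun_div {p q : ℝ} (hp : 0 < p) :
    p * klFun (q / p) = q * Real.log q - q * Real.log p + p - q := by
  rcases eq_or_ne q 0 with rfl | hq
  · simp [klFun_zero]
  · rw [klFun, Real.log_div hq hp.ne']
    field_simp

/-- If `C + ε log P` splits as a sum `u i + v j` of dual potentials, then the entropic objective
of a doubly stochastic `Q` is the dual value plus `ε` times the divergence of `Q` from `P`. -/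
theorem entObj_eq_add_klFun {ι : Type*} [Fintype ι] {C P Q : Matrix ι ι ℝ} {ε : ℝ} {u v : ι → ℝ}
    (hP : IsDoublyStochastic P) (hpos : ∀ i j, 0 < P i j)
    (hdual : ∀ i j, C i j + ε * Real.log (P i j) = u i + v j) (hQ : IsDoublyStochastic Q) :
    entObj C ε Q = (∑ i, u i + ∑ j, v j) +
      ε * ∑ i, ∑ j, P i j * InformationTheory.klFun (Q i j / P i j) := by
  have hv : ∑ i, ∑ j, v j * Q i j = ∑ j, v j := by
    rw [Finset.sum_comm]
    simp_rw [← Finset.mul_sum, hQ.2.2, mul_one]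
  have hmass : ∑ i, ∑ j, (Q i j - P i j) = 0 := by
    simp [Finset.sum_sub_distrib, hQ.2.1, hP.2.1]
  have hterm (i j : ι) : C i j * Q i j + ε * (Q i j * Real.log (Q i j)) =
      u i * Q i j + v j * Q i j +
        ε * (P i j * InformationTheory.klFun (Q i j / P i j)) + ε * (Q i j - P i j) := by
    rw [mul_klFun_div (hpos i j)]
    linear_combination Q i j * hdual i j
  have hsum := Finset.sum_congr rfl fun i (_ : i ∈ Finset.univ) =>
    Finset.sum_congr rfl fun j (_ : j ∈ Finset.univ) => hterm i j
  simp only [Finset.sum_add_distrib, ← Finset.mul_sum, hmass, hQ.2.1, mul_one, hv] at hsum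
  rw [entObj, hsum]
  ring

theorem entObj_eq_dual_value {ι : Type*} [Fintype ι] {C P : Matrix ι ι ℝ} {ε : ℝ} {u v : ι → ℝ}
    (hP : IsDoublyStochastic P) (hpos : ∀ i j, 0 < P i j)
    (hdual : ∀ i j, C i j + ε * Real.log (P i j) = u i + v j) :
    entObj C ε P = ∑ i, u i + ∑ j, v j := by
  simp [entObj_eq_add_klFun hP hpos hdual hP, div_self (hpos _ _).ne',
    InformationTheory.klFun_one]

theorem mul_klFun_div_nonneg {p q : ℝ} (hp : 0 < p) (hq : 0 ≤ q) :
    0 ≤ p * InformationTheory.klFun (q / p) :=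
  mul_nonneg hp.le (InformationTheory.klFun_nonneg (div_nonneg hq hp.le))

theorem entObj_le_of_dual {ι : Type*} [Fintype ι] {C P Q : Matrix ι ι ℝ} {ε : ℝ} {u v : ι → ℝ}
    (hε : 0 < ε) (hP : IsDoublyStochastic P) (hpos : ∀ i j, 0 < P i j)
    (hdual : ∀ i j, C i j + ε * Real.log (P i j) = u i + v j) (hQ : IsDoublyStochastic Q) :
    entObj C ε P ≤ entObj C ε Q := by
  rw [entObj_eq_dual_value hP hpos hdual, entObj_eq_add_klFun hP hpos hdual hQ]
  exact le_add_of_nonneg_right <| mul_nonneg hε.le <| Finset.sum_nonneg fun i _ =>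
    Finset.sum_nonneg fun j _ => mul_klFun_div_nonneg (hpos i j) (hQ.1 i j)

theorem eq_of_entObj_le_of_dual {ι : Type*} [Fintype ι] {C P Q : Matrix ι ι ℝ} {ε : ℝ}
    {u v : ι → ℝ} (hε : 0 < ε) (hP : IsDoublyStochastic P) (hpos : ∀ i j, 0 < P i j)
    (hdual : ∀ i j, C i j + ε * Real.log (P i j) = u i + v j) (hQ : IsDoublyStochastic Q)
    (hle : entObj C ε Q ≤ entObj C ε P) : Q = P := by
  rw [entObj_eq_dual_value hP hpos hdual, entObj_eq_add_klFun hP hpos hdual hQ,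
    add_le_iff_nonpos_right] at hle
  have hnn (i j : ι) := mul_klFun_div_nonneg (hpos i j) (hQ.1 i j)
  have hrow (i : ι) := Finset.sum_nonneg fun j (_ : j ∈ Finset.univ) => hnn i j
  have hzero := le_antisymm (nonpos_of_mul_nonpos_right hle hε)
    (Finset.sum_nonneg fun i _ => hrow i)
  ext i j
  have hi := (Finset.sum_eq_zero_iff_of_nonneg fun i _ => hrow i).1 hzero i (Finset.mem_univ i)
  have hij := (Finset.sum_eq_zero_iff_of_nonneg fun j _ => hnn i j).1 hi j (Finset.mem_univ j)
  have hkl := (mul_eq_zero.1 hij).resolve_left (hpos i j).ne'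
  rw [InformationTheory.klFun_eq_zero_iff (div_nonneg (hQ.1 i j) (hpos i j).le)] at hkl
  exact (div_eq_one_iff_eq (hpos i j).ne').1 hkl

theorem sum_ite_eq_add_sub_one_mul {ι : Type*} [Fintype ι] [DecidableEq ι] (i : ι) (a b : ℝ) :
    ∑ j, (if i = j then a else b) = a + ((Fintype.card ι : ℝ) - 1) * b := by
  have h (j : ι) : (if i = j then a else b) = (if i = j then a - b else 0) + b := by
    split_ifs <;> ring
  simp_rw [h, Finset.sum_add_distrib, Finset.sum_ite_eq]
  simp
  ring

theorem isDoublyStochastic_ite {ι : Type*} [Fintype ι] [DecidableEq ι] {a b : ℝ}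
    (ha : 0 ≤ a) (hb : 0 ≤ b) (hab : a + ((Fintype.card ι : ℝ) - 1) * b = 1) :
    IsDoublyStochastic (fun i j : ι => if i = j then a else b) := by
  refine ⟨fun i j => ?_, fun i => ?_, fun j => ?_⟩
  · dsimp only
    split_ifs <;> assumption
  · rw [sum_ite_eq_add_sub_one_mul, hab]
  · simp_rw [eq_comm (b := j)]
    rw [sum_ite_eq_add_sub_one_mul, hab]

/-- For the symmetric margin cost with margin `δ` and inverse temperature `β`, the matrix with
diagonal entries `a = 1/(1 + (n−1)e^{−βδ})` and off-diagonal entries `b = a·e^{−βδ}` is doubly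
stochastic, satisfies `a + (n−1)b = 1` and `a/b = e^{βδ}`, and is the unique minimizer of the
entropic assignment objective `F_{C,1/β}` over the Birkhoff polytope. -/
theorem symmetric_block_entropic_minimizer
    (n : ℕ) (hn : 2 ≤ n) (δ β : ℝ) (hδ : 0 < δ) (hβ : 0 < β) :
    let C := marginCost n δ
    let a : ℝ := 1 / (1 + ((n : ℝ) - 1) * Real.exp (-(β * δ)))
    let b : ℝ := a * Real.exp (-(β * δ))
    let P : Matrix (Fin n) (Fin n) ℝ := fun i j => if i = j then a else b
    IsDoublyStochastic P ∧
    a + ((n : ℝ) - 1) * b = 1 ∧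
    a / b = Real.exp (β * δ) ∧
    (∀ Q : Matrix (Fin n) (Fin n) ℝ, IsDoublyStochastic Q →
      entObj C (1 / β) P ≤ entObj C (1 / β) Q) ∧
    (∀ Q : Matrix (Fin n) (Fin n) ℝ, IsDoublyStochastic Q →
      (∀ R : Matrix (Fin n) (Fin n) ℝ, IsDoublyStochastic R →
        entObj C (1 / β) Q ≤ entObj C (1 / β) R) → Q = P) := by
  intro C a b P
  have hn1 : (1 : ℝ) ≤ n := by exact_mod_cast (by omega : 1 ≤ n)
  have hexp : 0 < Real.exp (-(β * δ)) := Real.exp_pos _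
  have hden : 0 < 1 + ((n : ℝ) - 1) * Real.exp (-(β * δ)) := by
    have := mul_nonneg (sub_nonneg.2 hn1) hexp.le
    linarith
  have ha : 0 < a := one_div_pos.2 hden
  have hb : 0 < b := mul_pos ha hexp
  have hsum : a + ((n : ℝ) - 1) * b = 1 := by
    simp only [b, a]
    field_simp
  have hratio : a / b = Real.exp (β * δ) := by
    simp only [b]
    rw [Real.exp_neg]
    field_simp
  have hP : IsDoublyStochastic P :=
    isDoublyStochastic_ite ha.le hb.le (by simpa using hsum)
  have hpos (i j : Fin n) : 0 < P i j := by
    simp only [P]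
    split_ifs <;> assumption
  have hdual (i j : Fin n) :
      C i j + 1 / β * Real.log (P i j) = 1 / β * Real.log a + 0 := by
    simp only [C, P, marginCost]
    split_ifs
    · ring
    · simp only [b]
      rw [Real.log_mul ha.ne' hexp.ne', Real.log_exp]
      field_simp
      ring
  have hε : 0 < 1 / β := one_div_pos.2 hβ
  exact ⟨hP, hsum, hratio,
    fun Q hQ => entObj_le_of_dual (v := fun _ => 0) hε hP hpos hdual hQ,
    fun Q hQ hmin => eq_of_entObj_le_of_dual (v := fun _ => 0) hε hP hpos hdual hQ (hmin P hP)⟩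
end

section
/- Let n ≥ 2, Δ > 0, ε ∈ (0, 1/2), and β > 0, and let C be the symmetric margin cost on n elements with margin Δ. If the unique minimizer P_β of the entropic assignment objective F_{C,1/β} over the Birkhoff polytope B_n satisfies P_{β,ii} ≥ 1 − ε for every i, then β ≥ (1/Δ)·log((n−1)(1−ε)/ε). -/
open scoped BigOperators

open InformationTheory in
/-- The Gibbs identity: relative to a doubly stochastic Gibbs matrix `Q = exp (-β C) / Z`, the
entropic objective is a Kullback-Leibler divergence up to a constant. -/
theorem mul_entObj_eq_sum_klFun {ι : Type*} [Fintype ι] {C P Q : Matrix ι ι ℝ} {β Z : ℝ}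
    (hβ : β ≠ 0) (hZ : 0 < Z) (hQ : ∀ i j, Q i j = Real.exp (-(β * C i j)) / Z)
    (hQds : IsDoublyStochastic Q) (hP : IsDoublyStochastic P) :
    β * entObj C (1 / β) P =
      (∑ i, ∑ j, Q i j * klFun (P i j / Q i j)) - Fintype.card ι * Real.log Z := by
  have key : ∀ i j, Q i j * klFun (P i j / Q i j) =
      P i j * Real.log (P i j) + β * (C i j * P i j) + Real.log Z * P i j + Q i j - P i j := by
    intro i j
    have hq : 0 < Q i j := by rw [hQ]; positivity
    have hlog : Real.log (Q i j) = -(β * C i j) - Real.log Z := by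
      rw [hQ, Real.log_div (Real.exp_pos _).ne' hZ.ne', Real.log_exp]
    rcases eq_or_ne (P i j) 0 with h | h
    · simp [h, klFun_apply]
    · rw [klFun_apply, Real.log_div h hq.ne', hlog]
      field_simp
      ring
  simp_rw [key, entObj, Finset.sum_sub_distrib, Finset.sum_add_distrib, ← Finset.mul_sum,
    hP.2.1, hQds.2.1]
  simp
  field_simp
  ring

open InformationTheory in
/-- A doubly stochastic Gibbs matrix is the only minimizer of the entropic objective. -/
theorem eq_of_entObj_le_gibbs {ι : Type*} [Fintype ι] {C P Q : Matrix ι ι ℝ} {β Z : ℝ}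
    (hβ : 0 < β) (hZ : 0 < Z) (hQ : ∀ i j, Q i j = Real.exp (-(β * C i j)) / Z)
    (hQds : IsDoublyStochastic Q) (hP : IsDoublyStochastic P)
    (hle : entObj C (1 / β) P ≤ entObj C (1 / β) Q) : P = Q := by
  have hq : ∀ i j, 0 < Q i j := fun i j => by rw [hQ]; positivity
  have hPe := mul_entObj_eq_sum_klFun hβ.ne' hZ hQ hQds hP
  have hQe := mul_entObj_eq_sum_klFun hβ.ne' hZ hQ hQds hQds
  simp only [div_self (hq _ _).ne', klFun_one, mul_zero, Finset.sum_const_zero] at hQe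
  have hnn : ∀ i j, 0 ≤ Q i j * klFun (P i j / Q i j) := fun i j =>
    mul_nonneg (hq i j).le (klFun_nonneg (div_nonneg (hP.1 i j) (hq i j).le))
  have hsum : ∑ i, ∑ j, Q i j * klFun (P i j / Q i j) = 0 := by
    refine le_antisymm ?_ (Finset.sum_nonneg fun i _ => Finset.sum_nonneg fun j _ => hnn i j)
    linarith [mul_le_mul_of_nonneg_left hle hβ.le]
  ext i j
  have hrow := (Finset.sum_eq_zero_iff_of_nonneg
    fun i _ => Finset.sum_nonneg fun j _ => hnn i j).1 hsum i (Finset.mem_univ i)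
  have hij := (Finset.sum_eq_zero_iff_of_nonneg fun j _ => hnn i j).1 hrow j (Finset.mem_univ j)
  have hkl := (mul_eq_zero.1 hij).resolve_left (hq i j).ne'
  rw [klFun_eq_zero_iff (div_nonneg (hP.1 i j) (hq i j).le)] at hkl
  exact (div_eq_one_iff_eq (hq i j).ne').1 hkl

/-- The Gibbs matrix of the symmetric margin cost, normalized by its common row sum, is doubly
stochastic. -/
theorem isDoublyStochastic_gibbs_marginCost {n : ℕ} (hn : 1 ≤ n) (β m : ℝ) :
    IsDoublyStochastic (fun i j => Real.exp (-(β * marginCost n m i j)) /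
      (1 + ((n : ℝ) - 1) * Real.exp (-(β * m)))) := by
  have hn' : (1 : ℝ) ≤ n := by exact_mod_cast hn
  have hZ : 0 < 1 + ((n : ℝ) - 1) * Real.exp (-(β * m)) := by
    have := mul_nonneg (sub_nonneg.2 hn') (Real.exp_pos (-(β * m))).le
    linarith
  have hsymm : ∀ i j, marginCost n m i j = marginCost n m j i := fun i j => by
    simp [marginCost, eq_comm]
  have hrow : ∀ i, ∑ j, Real.exp (-(β * marginCost n m i j)) /
      (1 + ((n : ℝ) - 1) * Real.exp (-(β * m))) = 1 := by
    intro i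
    rw [← Finset.sum_div, div_eq_one_iff_eq hZ.ne']
    rw [← Finset.add_sum_erase _ _ (Finset.mem_univ i)]
    rw [Finset.sum_congr rfl fun j hj => by
      rw [marginCost, if_neg (Finset.ne_of_mem_erase hj).symm]]
    simp [marginCost, Nat.cast_sub hn]
  refine ⟨fun i j => by positivity, hrow, fun j => ?_⟩
  simpa only [hsymm _ j] using hrow j

/-- Easy-block discretization: if the unique minimizer of the entropic assignment objective
`F_{C,1/β}` (symmetric margin cost with margin `Δ`) has all diagonal entries at least `1 − ε`,
then `β ≥ (1/Δ)·log((n−1)(1−ε)/ε)`. -/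
theorem easy_block_discretization_requires_large_beta
    (n : ℕ) (hn : 2 ≤ n) (Δ ε β : ℝ) (hΔ : 0 < Δ) (hε : 0 < ε) (hε' : ε < 1 / 2)
    (hβ : 0 < β)
    (P : Matrix (Fin n) (Fin n) ℝ) (hP : IsDoublyStochastic P)
    (hmin : ∀ Q : Matrix (Fin n) (Fin n) ℝ, IsDoublyStochastic Q →
      entObj (marginCost n Δ) (1 / β) P ≤ entObj (marginCost n Δ) (1 / β) Q)
    (hdiag : ∀ i, 1 - ε ≤ P i i) :
    (1 / Δ) * Real.log (((n : ℝ) - 1) * (1 - ε) / ε) ≤ β := by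
  have hn' : (2 : ℝ) ≤ n := by exact_mod_cast hn
  have hK := Real.exp_pos (-(β * Δ))
  have hZ : 0 < 1 + ((n : ℝ) - 1) * Real.exp (-(β * Δ)) := by
    have := mul_nonneg (by linarith : (0 : ℝ) ≤ n - 1) hK.le
    linarith
  have hQ := isDoublyStochastic_gibbs_marginCost (by omega : 1 ≤ n) β Δ
  have hPQ := eq_of_entObj_le_gibbs hβ hZ (fun _ _ => rfl) hQ hP (hmin _ hQ)
  have hd := hdiag ⟨0, by omega⟩
  simp only [hPQ, marginCost, if_true, mul_zero, neg_zero, Real.exp_zero] at hd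
  rw [le_div_iff₀ hZ] at hd
  have hone : Real.exp (-(β * Δ)) * Real.exp (β * Δ) = 1 := by
    rw [← Real.exp_add, neg_add_cancel, Real.exp_zero]
  have hE := Real.exp_pos (β * Δ)
  have hle : ((n : ℝ) - 1) * (1 - ε) / ε ≤ Real.exp (β * Δ) := by
    rw [div_le_iff₀ hε]
    have hscaled : ((n : ℝ) - 1) * (1 - ε) * Real.exp (-(β * Δ)) ≤ ε := by linarith
    calc ((n : ℝ) - 1) * (1 - ε)
        = ((n : ℝ) - 1) * (1 - ε) * Real.exp (-(β * Δ)) * Real.exp (β * Δ) := by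
          rw [mul_assoc _ (Real.exp _), hone, mul_one]
      _ ≤ ε * Real.exp (β * Δ) := mul_le_mul_of_nonneg_right hscaled hE.le
      _ = Real.exp (β * Δ) * ε := mul_comm _ _
  have hpos : 0 < ((n : ℝ) - 1) * (1 - ε) / ε :=
    div_pos (mul_pos (by linarith) (by linarith)) hε
  rw [one_div, inv_mul_le_iff₀ hΔ, mul_comm Δ]
  exact (Real.log_le_iff_le_exp hpos).2 hle
end

section
/- Let n ≥ 2, δ > 0, η ∈ (0, 1/2), and β > 0, and let C be the symmetric margin cost on n elements with margin δ. If the unique minimizer P_β of the entropic assignment objective F_{C,1/β} over the Birkhoff polytope B_n satisfies P_{β,ii} ≤ 1 − η for every i, then β ≤ (1/δ)·log((n−1)(1−η)/η). -/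
open scoped BigOperators

/-- The pointwise Gibbs inequality, strict away from the diagonal. -/
theorem mul_log_gibbs_pos_of_ne {p q : ℝ} (hp : 0 ≤ p) (hq : 0 < q) (hpq : p ≠ q) :
    0 < p * Real.log p - p * Real.log q + q - p := by
  rcases hp.eq_or_lt with rfl | hp
  · simpa using hq
  · have h1 : q / p ≠ 1 := fun h => hpq ((div_eq_one_iff_eq hp.ne').1 h).symm
    have h := Real.log_lt_sub_one_of_pos (div_pos hq hp) h1
    rw [Real.log_div hq.ne' hp.ne'] at h
    have h2 := mul_lt_mul_of_pos_left h hp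
    have h3 : p * (q / p - 1) = q - p := by field_simp
    linarith

theorem mul_log_gibbs_nonneg {p q : ℝ} (hp : 0 ≤ p) (hq : 0 < q) :
    0 ≤ p * Real.log p - p * Real.log q + q - p := by
  by_cases h : p = q
  · simp [h]
  · exact (mul_log_gibbs_pos_of_ne hp hq h).le

/-- If a positive doubly stochastic `Q` has the Gibbs form `log Q = L - β C`, then every
minimizer of the entropic objective equals `Q`. -/
theorem eq_of_entObj_le_of_log_eq {ι : Type*} [Fintype ι] {C P Q : Matrix ι ι ℝ} {β L : ℝ}
    (hβ : 0 < β) (hP : IsDoublyStochastic P) (hQ : IsDoublyStochastic Q)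
    (hpos : ∀ i j, 0 < Q i j) (hlog : ∀ i j, Real.log (Q i j) = L - β * C i j)
    (hle : entObj C (1 / β) P ≤ entObj C (1 / β) Q) (i j : ι) : P i j = Q i j := by
  have key : ∀ R : Matrix ι ι ℝ, IsDoublyStochastic R →
      β * entObj C (1 / β) R =
        (∑ i, ∑ j, (R i j * Real.log (R i j) - R i j * Real.log (Q i j) + Q i j - R i j))
          + Fintype.card ι * L := by
    intro R hR
    have h1 : ∑ i, ∑ j, R i j * L = Fintype.card ι * L := by
      simp [← Finset.sum_mul, hR.2.1]
    have h2 : β * entObj C (1 / β) R =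
        β * (∑ i, ∑ j, C i j * R i j) + ∑ i, ∑ j, R i j * Real.log (R i j) := by
      unfold entObj
      field_simp
    rw [h2, ← h1]
    simp only [hlog, Finset.sum_add_distrib, Finset.sum_sub_distrib, hR.2.1, hQ.2.1, mul_sub,
      Finset.mul_sum]
    have h3 : ∑ i, ∑ j, R i j * (β * C i j) = ∑ i, ∑ j, β * (C i j * R i j) :=
      Finset.sum_congr rfl fun i _ => Finset.sum_congr rfl fun j _ => by ring
    rw [h3]
    ring
  have hg : ∀ i j, 0 ≤ P i j * Real.log (P i j) - P i j * Real.log (Q i j) + Q i j - P i j :=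
    fun i j => mul_log_gibbs_nonneg (hP.1 i j) (hpos i j)
  have hle' := mul_le_mul_of_nonneg_left hle hβ.le
  rw [key P hP, key Q hQ] at hle'
  simp only [sub_self, zero_add, Finset.sum_const_zero] at hle'
  by_contra hne
  have hlt := mul_log_gibbs_pos_of_ne (hP.1 i j) (hpos i j) hne
  have hrow := Finset.single_le_sum (fun k _ => hg i k) (Finset.mem_univ j)
  have hall := Finset.single_le_sum
    (fun k _ => Finset.sum_nonneg (s := Finset.univ) fun l _ => hg k l) (Finset.mem_univ i)
  linarith

/-- Hard-block non-discretization: if the unique minimizer of the entropic assignment objective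
`F_{C,1/β}` (symmetric margin cost with margin `δ`) has all diagonal entries at most `1 − η`,
then `β ≤ (1/δ)·log((n−1)(1−η)/η)`. -/
theorem hard_block_diffuse_requires_small_beta
    (n : ℕ) (hn : 2 ≤ n) (δ η β : ℝ) (hδ : 0 < δ) (hη : 0 < η) (hη' : η < 1 / 2)
    (hβ : 0 < β)
    (P : Matrix (Fin n) (Fin n) ℝ) (hP : IsDoublyStochastic P)
    (hmin : ∀ Q : Matrix (Fin n) (Fin n) ℝ, IsDoublyStochastic Q →
      entObj (marginCost n δ) (1 / β) P ≤ entObj (marginCost n δ) (1 / β) Q)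
    (hdiag : ∀ i, P i i ≤ 1 - η) :
    β ≤ (1 / δ) * Real.log (((n : ℝ) - 1) * (1 - η) / η) := by
  have hn1 : (1 : ℝ) ≤ (n : ℝ) - 1 := by
    have : (2 : ℝ) ≤ n := by exact_mod_cast hn
    linarith
  have hE := Real.exp_pos (β * δ)
  set E := Real.exp (β * δ) with hE_def
  have hZ : 0 < E + ((n : ℝ) - 1) := by linarith
  let Q : Matrix (Fin n) (Fin n) ℝ := fun i j =>
    if i = j then E / (E + ((n : ℝ) - 1)) else 1 / (E + ((n : ℝ) - 1))
  have hpos : ∀ i j, 0 < Q i j := by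
    intro i j
    dsimp only [Q]
    split_ifs <;> positivity
  have hsplit : ∀ i j, Q i j =
      (if i = j then (E - 1) / (E + ((n : ℝ) - 1)) else 0) + 1 / (E + ((n : ℝ) - 1)) := by
    intro i j
    dsimp only [Q]
    split_ifs
    · rw [← add_div, sub_add_cancel]
    · rw [zero_add]
  have hQ : IsDoublyStochastic Q := by
    refine ⟨fun i j => (hpos i j).le, fun i => ?_, fun j => ?_⟩ <;>
    · simp only [hsplit, Finset.sum_add_distrib, Finset.sum_ite_eq, Finset.sum_ite_eq',
        Finset.mem_univ, if_true, Finset.sum_const, Finset.card_univ, Fintype.card_fin,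
        nsmul_eq_mul]
      field_simp
      ring
  have hlog : ∀ i j, Real.log (Q i j) =
      Real.log (E / (E + ((n : ℝ) - 1))) - β * marginCost n δ i j := by
    intro i j
    dsimp only [Q, marginCost]
    split_ifs
    · simp
    · rw [Real.log_div hE.ne' hZ.ne', Real.log_div one_ne_zero hZ.ne', Real.log_one, hE_def,
        Real.log_exp]
      ring
  have hPQ := eq_of_entObj_le_of_log_eq hβ hP hQ hpos hlog (hmin Q hQ)
  let i₀ : Fin n := ⟨0, by omega⟩
  have hd := hdiag i₀
  rw [hPQ i₀ i₀] at hd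
  simp only [Q, if_true] at hd
  rw [div_le_iff₀ hZ] at hd
  have hb : E ≤ ((n : ℝ) - 1) * (1 - η) / η := by
    rw [le_div_iff₀ hη]
    linarith
  have hl := Real.log_le_log hE hb
  rw [hE_def, Real.log_exp] at hl
  rw [one_div, inv_mul_eq_div, le_div_iff₀ hδ]
  exact hl
end

section
/- Let n1, n2 ≥ 2, ε ∈ (0, 1/2), η ∈ (0, 1/2), and let Δ, δ > 0 satisfy (1/Δ)·log((n1−1)(1−ε)/ε) > (1/δ)·log((n2−1)(1−η)/η). Then there is no β > 0 such that both 1/(1 + (n1−1)e^{−βΔ}) ≥ 1 − ε and 1/(1 + (n2−1)e^{−βδ}) ≤ 1 − η hold. -/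
/-- The diagonal entry `1 / (1 + k e^{-βm})` is at least `1 - ε` exactly when `β` is at least the
threshold `(1 / m) log (k (1 - ε) / ε)`. -/
theorem one_sub_le_diagonal_iff {k ε m β : ℝ} (hk : 0 < k) (hε : 0 < ε) (hε' : ε < 1)
    (hm : 0 < m) :
    1 - ε ≤ 1 / (1 + k * Real.exp (-(β * m))) ↔ (1 / m) * Real.log (k * (1 - ε) / ε) ≤ β := by
  have h1ε : 0 < 1 - ε := sub_pos.2 hε'
  have he := Real.exp_pos (β * m)
  rw [one_div_mul_eq_div, div_le_iff₀ hm, Real.log_le_iff_le_exp (by positivity),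
    div_le_iff₀ hε, le_div_iff₀ (by positivity), Real.exp_neg, ← mul_le_mul_iff_left₀ he]
  field_simp
  constructor <;> intro h <;> linarith

/-- The diagonal entry `1 / (1 + k e^{-βm})` is at most `1 - η` exactly when `β` is at most the
threshold `(1 / m) log (k (1 - η) / η)`. -/
theorem diagonal_le_one_sub_iff {k η m β : ℝ} (hk : 0 < k) (hη : 0 < η) (hη' : η < 1)
    (hm : 0 < m) :
    1 / (1 + k * Real.exp (-(β * m))) ≤ 1 - η ↔ β ≤ (1 / m) * Real.log (k * (1 - η) / η) := by
  have h1η : 0 < 1 - η := sub_pos.2 hη'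
  have he := Real.exp_pos (β * m)
  rw [one_div_mul_eq_div, le_div_iff₀ hm, Real.le_log_iff_exp_le (by positivity),
    le_div_iff₀ hη, div_le_iff₀ (by positivity), Real.exp_neg, ← mul_le_mul_iff_left₀ he]
  field_simp
  constructor <;> intro h <;> linarith

/-- If `(1/Δ)·log((n1−1)(1−ε)/ε) > (1/δ)·log((n2−1)(1−η)/η)`, then there is no `β > 0` with both
`1/(1 + (n1−1)e^{−βΔ}) ≥ 1 − ε` (easy block discretizes) and
`1/(1 + (n2−1)e^{−βδ}) ≤ 1 − η` (hard block stays diffuse). -/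
theorem no_global_beta_of_incompatible_thresholds
    (n1 n2 : ℕ) (hn1 : 2 ≤ n1) (hn2 : 2 ≤ n2)
    (ε η Δ δ : ℝ) (hε : 0 < ε) (hε' : ε < 1 / 2) (hη : 0 < η) (hη' : η < 1 / 2)
    (hΔ : 0 < Δ) (hδ : 0 < δ)
    (hgap : (1 / Δ) * Real.log (((n1 : ℝ) - 1) * (1 - ε) / ε) >
      (1 / δ) * Real.log (((n2 : ℝ) - 1) * (1 - η) / η)) :
    ¬ ∃ β : ℝ, 0 < β ∧
      1 - ε ≤ 1 / (1 + ((n1 : ℝ) - 1) * Real.exp (-(β * Δ))) ∧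
      1 / (1 + ((n2 : ℝ) - 1) * Real.exp (-(β * δ))) ≤ 1 - η := by
  rintro ⟨β, -, h1, h2⟩
  have hk1 : (0 : ℝ) < n1 - 1 := sub_pos.2 (by exact_mod_cast hn1)
  have hk2 : (0 : ℝ) < n2 - 1 := sub_pos.2 (by exact_mod_cast hn2)
  rw [one_sub_le_diagonal_iff hk1 hε (by linarith) hΔ] at h1
  rw [diagonal_le_one_sub_iff hk2 hη (by linarith) hδ] at h2
  exact (h1.trans h2).not_gt hgap
end

section
/- Let n1 ≥ n2 ≥ 2 and 0 < ε < η < 1/2. Then there exist Δ > δ > 0 such that there is no β > 0 for which both of the following hold: (1) the unique minimizer of the entropic assignment objective F_{C_Δ,1/β} over B_{n1}, where C_Δ is the symmetric margin cost on n1 elements with margin Δ, has all diagonal entries ≥ 1 − ε; and (2) the unique minimizer of F_{C_δ,1/β} over B_{n2}, where C_δ is the symmetric margin cost on n2 elements with margin δ, has all diagonal entries ≤ 1 − η. -/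
open scoped BigOperators

/-- A minimizer of the entropic objective over doubly stochastic matrices equals any positive
doubly stochastic matrix of Gibbs form for the cost. -/
lemma eq_gibbs_of_forall_entObj_le {ι : Type*} [Fintype ι] {C G P : Matrix ι ι ℝ} {t c : ℝ}
    (ht : 0 < t) (hG : IsDoublyStochastic G) (hpos : ∀ i j, 0 < G i j)
    (hC : ∀ i j, C i j = t * (c - Real.log (G i j))) (hP : IsDoublyStochastic P)
    (hmin : ∀ Q, IsDoublyStochastic Q → entObj C t P ≤ entObj C t Q) : P = G := by
  have key : ∀ Q : Matrix ι ι ℝ, IsDoublyStochastic Q → entObj C t Q =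
      t * (c * Fintype.card ι + ∑ i, ∑ j, G i j * InformationTheory.klFun (Q i j / G i j)) := by
    intro Q hQ
    have hterm : ∀ i j, G i j * InformationTheory.klFun (Q i j / G i j) =
        Q i j * Real.log (Q i j) - Q i j * Real.log (G i j) + G i j - Q i j := by
      intro i j
      have hg := (hpos i j).ne'
      rcases eq_or_ne (Q i j) 0 with h0 | h0
      · simp [h0, InformationTheory.klFun]
      · rw [InformationTheory.klFun, Real.log_div h0 hg]
        field_simp
    have hcost : ∑ i, ∑ j, C i j * Q i j =
        t * (c * Fintype.card ι - ∑ i, ∑ j, Q i j * Real.log (G i j)) := by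
      have hrow : ∀ i, ∑ j, C i j * Q i j = t * (c - ∑ j, Q i j * Real.log (G i j)) := by
        intro i
        calc ∑ j, C i j * Q i j
            = ∑ j, (t * c * Q i j - t * (Q i j * Real.log (G i j))) :=
              Finset.sum_congr rfl fun j _ => by rw [hC]; ring
          _ = _ := by
              rw [Finset.sum_sub_distrib, ← Finset.mul_sum, ← Finset.mul_sum, hQ.2.1 i]; ring
      simp only [hrow, ← Finset.mul_sum, Finset.sum_sub_distrib, Finset.sum_const,
        Finset.card_univ, nsmul_eq_mul]
      ring
    simp only [entObj, hcost, hterm, Finset.sum_sub_distrib, Finset.sum_add_distrib, hQ.2.1,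
      hG.2.1]
    ring
  have hle := hmin G hG
  rw [key P hP, key G hG] at hle
  have hGG : ∀ i j, G i j / G i j = 1 := fun i j => div_self (hpos i j).ne'
  simp only [hGG, InformationTheory.klFun_one, mul_zero, Finset.sum_const_zero, add_zero] at hle
  have hsum := le_of_mul_le_mul_left hle ht
  have hnn : ∀ i j, 0 ≤ G i j * InformationTheory.klFun (P i j / G i j) := fun i j =>
    mul_nonneg (hpos i j).le
      (InformationTheory.klFun_nonneg (div_nonneg (hP.1 i j) (hpos i j).le))
  have hzero : ∑ i, ∑ j, G i j * InformationTheory.klFun (P i j / G i j) = 0 :=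
    le_antisymm (by linarith) (Finset.sum_nonneg fun i _ => Finset.sum_nonneg fun j _ => hnn i j)
  ext i j
  rw [Finset.sum_eq_zero_iff_of_nonneg
    (fun i _ => Finset.sum_nonneg fun j _ => hnn i j)] at hzero
  have hi := hzero i (Finset.mem_univ i)
  rw [Finset.sum_eq_zero_iff_of_nonneg (fun j _ => hnn i j)] at hi
  have hij := (mul_eq_zero.mp (hi j (Finset.mem_univ j))).resolve_left (hpos i j).ne'
  rw [InformationTheory.klFun_eq_zero_iff (div_nonneg (hP.1 i j) (hpos i j).le)] at hij
  exact (div_eq_one_iff_eq (hpos i j).ne').mp hij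

/-- Diagonal entries of the minimizer for the symmetric margin cost. -/
lemma diag_eq_of_forall_entObj_marginCost_le {n : ℕ} (hn : 1 ≤ n) {m β : ℝ} (hβ : 0 < β)
    {P : Matrix (Fin n) (Fin n) ℝ} (hP : IsDoublyStochastic P)
    (hmin : ∀ Q, IsDoublyStochastic Q →
      entObj (marginCost n m) (1 / β) P ≤ entObj (marginCost n m) (1 / β) Q) (i : Fin n) :
    P i i = 1 / (1 + (n - 1) * Real.exp (-(β * m))) := by
  have hn' : (0 : ℝ) ≤ n - 1 := sub_nonneg.mpr (by exact_mod_cast hn)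
  set e := Real.exp (-(β * m)) with he
  have hepos : 0 < e := Real.exp_pos _
  have hD : 0 < 1 + (n - 1) * e := by positivity
  set d := 1 / (1 + (n - 1) * e) with hd
  have hdpos : 0 < d := by positivity
  have hsum : d - d * e + n * (d * e) = 1 := by
    rw [hd]; field_simp; ring
  let G : Matrix (Fin n) (Fin n) ℝ := fun i j => if i = j then d else d * e
  have hsplit : ∀ i j, G i j = (if i = j then d - d * e else 0) + d * e := by
    intro i j
    by_cases h : i = j <;> simp [G, h]
  have hpos : ∀ i j, 0 < G i j := by
    intro i j
    by_cases h : i = j <;> simp only [G, h, if_true, if_false] <;> positivity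
  have hG : IsDoublyStochastic G := by
    refine ⟨fun i j => (hpos i j).le, fun i => ?_, fun j => ?_⟩ <;>
      simp [hsplit, Finset.sum_add_distrib, hsum]
  have hC : ∀ i j, marginCost n m i j = 1 / β * (Real.log d - Real.log (G i j)) := by
    intro i j
    by_cases h : i = j
    · simp [G, marginCost, h]
    · simp only [G, marginCost, h, if_false]
      rw [Real.log_mul hdpos.ne' hepos.ne', he, Real.log_exp]
      field_simp
      ring
  rw [eq_gibbs_of_forall_entObj_le (one_div_pos.mpr hβ) hG hpos hC hP hmin]
  simp [G]

/-- The Gibbs diagonal weight is at least `1 - a` exactly when the scaled margin `x` is at least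
`log (k * (1 - a) / a)`. -/
lemma one_sub_le_gibbs_diag_iff {k a x : ℝ} (hk : 0 < k) (ha : 0 < a) (ha1 : a < 1) :
    1 - a ≤ 1 / (1 + k * Real.exp (-x)) ↔ Real.log (k * (1 - a) / a) ≤ x := by
  have h1 : 0 < 1 - a := sub_pos.mpr ha1
  have hx := Real.exp_pos x
  rw [Real.log_le_iff_le_exp (by positivity), Real.exp_neg, le_div_iff₀ (by positivity),
    div_le_iff₀ ha, ← mul_le_mul_iff_left₀ hx]
  field_simp
  constructor <;> intro h <;> nlinarith

/-- The Gibbs diagonal weight is at most `1 - a` exactly when the scaled margin `x` is at most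
`log (k * (1 - a) / a)`. -/
lemma gibbs_diag_le_one_sub_iff {k a x : ℝ} (hk : 0 < k) (ha : 0 < a) (ha1 : a < 1) :
    1 / (1 + k * Real.exp (-x)) ≤ 1 - a ↔ x ≤ Real.log (k * (1 - a) / a) := by
  have h1 : 0 < 1 - a := sub_pos.mpr ha1
  have hx := Real.exp_pos x
  rw [Real.le_log_iff_exp_le (by positivity), Real.exp_neg, div_le_iff₀ (by positivity),
    le_div_iff₀ ha, ← mul_le_mul_iff_left₀ hx]
  field_simp
  constructor <;> intro h <;> nlinarith

/-- Global-temperature trade-off: for `n1 ≥ n2 ≥ 2` and `0 < ε < η < 1/2` there exist margins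
`Δ > δ > 0` such that no single inverse temperature `β > 0` simultaneously makes the unique
minimizer for the large-margin (easy) block of size `n1` have all diagonal entries `≥ 1 − ε`
and the unique minimizer for the small-margin (hard) block of size `n2` have all diagonal
entries `≤ 1 − η`. -/
theorem no_global_temperature_tradeoff
    (n1 n2 : ℕ) (hn2 : 2 ≤ n2) (hn12 : n2 ≤ n1)
    (ε η : ℝ) (hε : 0 < ε) (hεη : ε < η) (hη : η < 1 / 2) :
    ∃ Δ δ : ℝ, 0 < δ ∧ δ < Δ ∧
      ¬ ∃ β : ℝ, 0 < β ∧
        (∃ P : Matrix (Fin n1) (Fin n1) ℝ, IsDoublyStochastic P ∧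
          (∀ Q : Matrix (Fin n1) (Fin n1) ℝ, IsDoublyStochastic Q →
            entObj (marginCost n1 Δ) (1 / β) P ≤ entObj (marginCost n1 Δ) (1 / β) Q) ∧
          (∀ i, 1 - ε ≤ P i i)) ∧
        (∃ P : Matrix (Fin n2) (Fin n2) ℝ, IsDoublyStochastic P ∧
          (∀ Q : Matrix (Fin n2) (Fin n2) ℝ, IsDoublyStochastic Q →
            entObj (marginCost n2 δ) (1 / β) P ≤ entObj (marginCost n2 δ) (1 / β) Q) ∧
          (∀ i, P i i ≤ 1 - η)) := by
  have hk2 : (1 : ℝ) ≤ n2 - 1 := by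
    have : (2 : ℝ) ≤ n2 := by exact_mod_cast hn2
    linarith
  have hk12 : (n2 : ℝ) - 1 ≤ n1 - 1 := by
    have : (n2 : ℝ) ≤ n1 := by exact_mod_cast hn12
    linarith
  have hη0 : 0 < η := hε.trans hεη
  set A1 := ((n1 : ℝ) - 1) * (1 - ε) / ε with hA1
  set A2 := ((n2 : ℝ) - 1) * (1 - η) / η with hA2
  have hA2one : 1 < A2 := by
    rw [hA2, lt_div_iff₀ hη0]; nlinarith
  have hA21 : A2 < A1 := by
    rw [hA1, hA2]
    have : (1 - η) / η < (1 - ε) / ε := by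
      rw [div_lt_div_iff₀ hη0 hε]; nlinarith
    have h0 : 0 < (1 - ε) / ε := div_pos (by linarith) hε
    rw [mul_div_assoc, mul_div_assoc]
    nlinarith
  have hlog2 : 0 < Real.log A2 := Real.log_pos hA2one
  have hlog : Real.log A2 < Real.log A1 := Real.log_lt_log (by linarith) hA21
  refine ⟨(Real.log A1 + Real.log A2) / 2, Real.log A2, hlog2, by linarith, ?_⟩
  rintro ⟨β, hβ, ⟨P, hP, hPmin, hPdiag⟩, ⟨Q, hQ, hQmin, hQdiag⟩⟩
  have h1 := hPdiag ⟨0, by omega⟩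
  have h2 := hQdiag ⟨0, by omega⟩
  rw [diag_eq_of_forall_entObj_marginCost_le (by omega) hβ hP hPmin,
    one_sub_le_gibbs_diag_iff (by linarith) hε (by linarith)] at h1
  rw [diag_eq_of_forall_entObj_marginCost_le (by omega) hβ hQ hQmin,
    gibbs_diag_le_one_sub_iff (by linarith) hη0 (by linarith)] at h2
  have hβ1 : β ≤ 1 := by
    by_contra! h
    nlinarith
  nlinarith
end
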